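/- arXiv:1311.4133 — 2 statements merged into one kernel-verified Lean document; each statement's English description precedes it below -/
import Mathlib

section
/- Let A : ℕ → ℤ be a sequence satisfying a polynomial recurrence A(n+r) = p(A(n+r−1), …, A(n)) for all n, where p ∈ ℤ[T_1, …, T_r]. Then either limsup_{n→∞} log log |A(n)| / log n ≥ 1/r, or else there is a positive integer d such that for each i with 0 ≤ i < d there is a polynomial p_i with rational coefficients satisfying A(nd + i) = p_i(n) for all sufficiently large n. -/
open Filter

/-- The `N × N` Hankel matrix `(a (i + j))` of a sequence. -/
def hankelMatrix {R : Type*} (a : ℕ → R) (N : ℕ) : Matrix (Fin N) (Fin N) R :=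
  Matrix.of fun i j => a (i + j)

theorem pow_dvd_det_hankelMatrix {A : ℕ → ℤ} {m : ℤ} {b d : ℕ} (hd : 0 < d) (hdb : d ≤ b)
    (h : ∀ n, b ≤ n → m ∣ A n - A (n - d)) (N : ℕ) :
    m ^ (N - b) ∣ (hankelMatrix A N).det := by
  let U : Matrix (Fin N) (Fin N) ℤ := Matrix.of fun i j =>
    (if i = j then 1 else 0) - if b ≤ (j : ℕ) ∧ (i : ℕ) + d = j then 1 else 0
  have hU : U.det = 1 := by
    rw [Matrix.det_of_isUpperTriangular]
    · refine Finset.prod_eq_one fun i _ => ?_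
      simp [U, hd.ne']
    · intro i j hij
      have hij' : (j : ℕ) < i := hij
      have h1 : i ≠ j := by rintro rfl; omega
      have h2 : ¬ (b ≤ (j : ℕ) ∧ (i : ℕ) + d = j) := by omega
      simp [U, h1, h2]
  have hmul (i j : Fin N) : (hankelMatrix A N * U) i j =
      A (i + j) - if b ≤ (j : ℕ) then A (i + j - d) else 0 := by
    simp only [Matrix.mul_apply, hankelMatrix, U, Matrix.of_apply, mul_sub, Finset.sum_sub_distrib]
    congr 1
    · simp
    · split_ifs with hj
      · rw [Finset.sum_eq_single ⟨j - d, by omega⟩]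
        · rw [if_pos ⟨hj, by simp; omega⟩, mul_one]
          congr 1
          simp only
          omega
        · intro k _ hk
          rw [if_neg, mul_zero]
          rintro ⟨-, hk'⟩
          exact hk (Fin.ext (by simp only; omega))
        · simp
      · simp [hj]
  let v : Fin N → ℤ := fun j => if b ≤ (j : ℕ) then m else 1
  have hv (i j : Fin N) : v j ∣ (hankelMatrix A N * U) i j := by
    rw [hmul]
    by_cases hj : b ≤ (j : ℕ)
    · simpa [v, hj] using h (i + j) (by omega)
    · simp [v, hj]
  choose W hW using hv
  have hdet : (hankelMatrix A N).det = (∏ j, v j) * (Matrix.of W).det := by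
    rw [← Matrix.det_mul_row, ← mul_one (hankelMatrix A N).det, ← hU, ← Matrix.det_mul]
    congr 1
    ext i j
    rw [hW, Matrix.of_apply, Matrix.of_apply]
  have hprod : ∏ j, v j = m ^ (N - b) := by
    rw [Fin.prod_univ_eq_prod_range (fun j => if b ≤ j then m else 1) N, Finset.prod_ite,
      Finset.prod_const, Finset.prod_const_one, mul_one]
    congr 1
    rw [show (Finset.range N).filter (fun j => b ≤ j) = Finset.Ico b N by ext; simp; omega,
      Nat.card_Ico]
  rw [hdet, hprod]
  exact dvd_mul_right _ _

theorem exists_period_mod {r : ℕ} {A : ℕ → ℤ} {p : MvPolynomial (Fin r) ℤ}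
    (hrec : ∀ n : ℕ, A (n + r) =
      MvPolynomial.eval (fun i : Fin r => A (n + r - 1 - (i : ℕ))) p)
    (m : ℕ) [NeZero m] :
    ∃ b d : ℕ, 0 < d ∧ d ≤ b ∧ b ≤ m ^ r ∧ ∀ n, b ≤ n → (m : ℤ) ∣ A n - A (n - d) := by
  obtain ⟨s, t, hst, hf⟩ := Fintype.exists_ne_map_eq_of_card_lt
    (fun (k : Fin (m ^ r + 1)) (i : Fin r) => (A (k + i) : ZMod m)) (by simp [ZMod.card])
  wlog hlt : s < t generalizing s t
  · exact this t s hst.symm hf.symm (lt_of_le_of_ne (not_lt.mp hlt) hst.symm)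
  have hlt' : (s : ℕ) < t := hlt
  have hcast (n : ℕ) : (A (n + r) : ZMod m) = MvPolynomial.eval₂ (Int.castRingHom (ZMod m))
      (fun i : Fin r => (A (n + r - 1 - (i : ℕ)) : ZMod m)) p := by
    rw [hrec, MvPolynomial.eval, ← eq_intCast (Int.castRingHom (ZMod m)),
      MvPolynomial.coe_eval₂Hom, MvPolynomial.eval₂_comp_left]
    rfl
  have key (k : ℕ) : (A (s + k) : ZMod m) = A (t + k) := by
    induction k using Nat.strong_induction_on with
    | _ k ih =>
      rcases lt_or_ge k r with hk | hk
      · exact congrFun hf ⟨k, hk⟩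
      · obtain ⟨l, rfl⟩ := Nat.exists_eq_add_of_le' hk
        rw [← add_assoc, ← add_assoc, hcast, hcast]
        congr 1
        funext i
        have := ih (l + r - 1 - i) (by omega)
        rwa [show (s : ℕ) + (l + r - 1 - i) = s + l + r - 1 - i by omega,
          show (t : ℕ) + (l + r - 1 - i) = t + l + r - 1 - i by omega] at this
  refine ⟨t, t - s, by omega, by omega, by omega, fun n hn => ?_⟩
  rw [← ZMod.intCast_zmod_eq_zero_iff_dvd]
  have := key (n - t)
  rw [show (s : ℕ) + (n - t) = n - (t - s) by omega, show (t : ℕ) + (n - t) = n by omega] at this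
  push_cast
  rw [this, sub_self]

theorem primorial_pow_dvd_det_hankelMatrix {r : ℕ} {A : ℕ → ℤ} {p : MvPolynomial (Fin r) ℤ}
    (hrec : ∀ n : ℕ, A (n + r) =
      MvPolynomial.eval (fun i : Fin r => A (n + r - 1 - (i : ℕ))) p) (x N : ℕ) :
    (primorial x : ℤ) ^ (N - x ^ r) ∣ (hankelMatrix A N).det := by
  rw [primorial, Nat.cast_prod, ← Finset.prod_pow]
  refine Finset.prod_dvd_of_coprime ?_ ?_
  · intro q hq l hl hql
    simp only [Finset.coe_filter, Set.mem_ofPred] at hq hl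
    exact (Nat.isCoprime_iff_coprime.mpr ((Nat.coprime_primes hq.2 hl.2).mpr hql)).pow
  · intro q hq
    simp only [Finset.mem_filter, Finset.mem_range] at hq
    have : NeZero q := ⟨hq.2.ne_zero⟩
    obtain ⟨b, d, hd, hdb, hb, h⟩ := exists_period_mod hrec q
    have hqx : q ^ r ≤ x ^ r := Nat.pow_le_pow_left (by omega) r
    exact (pow_dvd_pow _ (by omega)).trans (pow_dvd_det_hankelMatrix hd hdb h N)

theorem abs_det_hankelMatrix_le {A : ℕ → ℤ} {N : ℕ} {B : ℝ}
    (hB : ∀ m < 2 * N, |(A m : ℝ)| ≤ B) : |((hankelMatrix A N).det : ℝ)| ≤ (N * B) ^ N := by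
  have h := Matrix.det_le (A := (hankelMatrix A N).map (Int.castRingHom ℝ))
    (abv := AbsoluteValue.abs) (x := B) fun i j => by
      simpa [hankelMatrix] using hB (i + j) (by omega)
  rw [← RingHom.mapMatrix_apply, ← RingHom.map_det, Fintype.card_fin, nsmul_eq_mul] at h
  rcases N.eq_zero_or_pos with rfl | hN
  · simp
  have hB0 : 0 ≤ B := (abs_nonneg _).trans (hB 0 (by omega))
  rw [mul_pow]
  refine le_trans (by simpa using h) ?_
  gcongr
  exact_mod_cast Nat.factorial_le_pow N

open Asymptotics in
theorem isLittleO_rpow_id_atTop {s : ℝ} (hs : s < 1) :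
    (fun x : ℝ => x ^ s) =o[atTop] fun x => x := by
  have hne : ∀ᶠ x : ℝ in atTop, x = 0 → x ^ s = 0 := by
    filter_upwards [eventually_ne_atTop 0] with x hx h using absurd h hx
  refine (isLittleO_iff_tendsto' hne).mpr ?_
  refine (tendsto_rpow_neg_atTop (sub_pos.mpr hs)).congr' ?_
  filter_upwards [eventually_gt_atTop 0] with x hx
  rw [neg_sub, Real.rpow_sub_one hx.ne']

open Asymptotics in
theorem eventually_lt_theta {s : ℝ} (hs : s < 1) (K₀ K₁ K₂ : ℝ) :
    ∀ᶠ x : ℕ in atTop, K₀ + K₁ * Real.log x + K₂ * (x : ℝ) ^ s < Chebyshev.theta x := by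
  have hlog : (fun x : ℝ => Real.log x) =o[atTop] fun x => x := Real.isLittleO_log_id_atTop
  have hconst (k : ℝ) : (fun _ : ℝ => k) =o[atTop] fun x : ℝ => x :=
    isLittleO_const_id_atTop k
  have hsucc : (fun x : ℝ => Real.log (x + 1)) =o[atTop] fun x => x := by
    have h1 : (fun x : ℝ => x + 1) =O[atTop] fun x => x :=
      (isBigO_refl _ _).add (hconst 1).isBigO
    exact (hlog.comp_tendsto (tendsto_atTop_add_const_right _ 1 tendsto_id)).trans_isBigO h1
  have hsqrt : (fun x : ℝ => 2 * √x * Real.log x) =o[atTop] fun x => x := by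
    have h2 : (fun x : ℝ => Real.log x) =o[atTop] fun x : ℝ => x ^ (1 / 2 : ℝ) :=
      isLittleO_log_rpow_atTop (by norm_num)
    have h3 : (fun x : ℝ => 2 * √x) =O[atTop] fun x : ℝ => x ^ (1 / 2 : ℝ) := by
      simp_rw [← Real.sqrt_eq_rpow]
      exact (isBigO_refl _ _).const_mul_left 2
    refine (h3.mul_isLittleO h2).trans_eventuallyEq ?_
    filter_upwards [eventually_ge_atTop 0] with x hx
    rw [← Real.sqrt_eq_rpow, Real.mul_self_sqrt hx]
  have hall := ((((hconst K₀).add (hlog.const_mul_left K₁)).add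
    ((isLittleO_rpow_id_atTop hs).const_mul_left K₂)).add hsucc).add hsqrt
  have hev := (hall.def (c := 1 / 2) (by norm_num)).and (eventually_gt_atTop 0)
  filter_upwards [tendsto_natCast_atTop_atTop.eventually hev] with x hx
  obtain ⟨hx, hx0⟩ := hx
  rw [Real.norm_eq_abs, Real.norm_of_nonneg hx0.le] at hx
  have h4 := le_of_abs_le hx
  have h5 := Chebyshev.theta_ge x
  nlinarith [Real.log_two_gt_d9]

theorem eventually_det_hankelMatrix_eq_zero {r : ℕ} (hr : 0 < r) {A : ℕ → ℤ}
    {p : MvPolynomial (Fin r) ℤ}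
    (hrec : ∀ n : ℕ, A (n + r) =
      MvPolynomial.eval (fun i : Fin r => A (n + r - 1 - (i : ℕ))) p)
    {c C : ℝ} (hc : 0 ≤ c) (hcr : c < 1 / r) (hC : 0 < C)
    (hA : ∀ n : ℕ, |(A n : ℝ)| ≤ C * Real.exp ((n : ℝ) ^ c)) :
    ∀ᶠ N : ℕ in atTop, (hankelMatrix A N).det = 0 := by
  have hr' : (0 : ℝ) < r := by exact_mod_cast hr
  have hs : r * c < 1 := by rwa [lt_div_iff₀ hr', mul_comm] at hcr
  set M : ℝ := 2 * 2 ^ r with hM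
  have hM0 : 0 < M := by positivity
  obtain ⟨x₀, hx₀⟩ := eventually_atTop.mp
    (eventually_lt_theta hs (2 * (Real.log M + Real.log C)) (2 * r) (2 * (2 * M) ^ c))
  filter_upwards [eventually_ge_atTop (2 * (x₀ + 1) ^ r)] with N hN
  by_contra hdet
  set x := Nat.findGreatest (fun y => 2 * y ^ r ≤ N) N with hx
  have hbound {y : ℕ} (hy : 2 * y ^ r ≤ N) : y ≤ N := by
    have := Nat.le_self_pow hr.ne' y
    omega
  have hxN : 2 * x ^ r ≤ N :=
    Nat.findGreatest_spec (P := fun y => 2 * y ^ r ≤ N) (hbound hN) hN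
  have hx₀x : x₀ + 1 ≤ x := Nat.le_findGreatest (hbound hN) hN
  have hNx : N < 2 * (x + 1) ^ r := by
    by_contra! h
    have := Nat.le_findGreatest (P := fun y => 2 * y ^ r ≤ N) (hbound h) h
    omega
  have hxpos : (0 : ℝ) < x := by exact_mod_cast (by omega : 0 < x)
  have hNpos : (0 : ℝ) < N := by
    have : 0 < x ^ r := Nat.pow_pos (by omega)
    exact_mod_cast (by omega : 0 < N)
  have hNM : (N : ℝ) ≤ M * (x : ℝ) ^ r := by
    have h1 : N ≤ 2 * (2 * x) ^ r :=
      hNx.le.trans (Nat.mul_le_mul_left _ (Nat.pow_le_pow_left (by omega) r))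
    calc (N : ℝ) ≤ ((2 * (2 * x) ^ r : ℕ) : ℝ) := by exact_mod_cast h1
      _ = M * (x : ℝ) ^ r := by push_cast; rw [mul_pow, hM]; ring
  set B : ℝ := C * Real.exp ((2 * N : ℝ) ^ c) with hB
  have hBpos : 0 < B := by positivity
  have hup : |((hankelMatrix A N).det : ℝ)| ≤ (N * B) ^ N := by
    refine abs_det_hankelMatrix_le fun m hm => (hA m).trans ?_
    have : (m : ℝ) ≤ 2 * N := by exact_mod_cast hm.le
    rw [hB]
    gcongr
  have hprim : (0 : ℝ) < primorial x := by exact_mod_cast primorial_pos x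
  have hlow : (primorial x : ℝ) ^ (N - x ^ r) ≤ |((hankelMatrix A N).det : ℝ)| := by
    have h1 := Int.le_of_dvd (abs_pos.mpr hdet)
      ((dvd_abs _ _).mpr (primorial_pow_dvd_det_hankelMatrix hrec x N))
    exact_mod_cast h1
  have hlogs := Real.log_le_log (by positivity) (hlow.trans hup)
  rw [Real.log_pow, Real.log_pow] at hlogs
  have htheta : Chebyshev.theta x = Real.log (primorial x) := by
    rw [Chebyshev.theta_eq_log_primorial, Nat.floor_natCast]
  rw [← htheta] at hlogs
  have hhalf : (N : ℝ) / 2 ≤ ((N - x ^ r : ℕ) : ℝ) := by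
    rw [Nat.cast_sub (by omega)]
    have : (2 * x ^ r : ℝ) ≤ N := by exact_mod_cast hxN
    push_cast
    linarith
  have hlogNB : Real.log (N * B) ≤
      Real.log M + Real.log C + r * Real.log x + (2 * M) ^ c * (x : ℝ) ^ (r * c) := by
    rw [Real.log_mul hNpos.ne' hBpos.ne', hB, Real.log_mul hC.ne' (Real.exp_pos _).ne',
      Real.log_exp]
    have h1 : Real.log N ≤ Real.log M + r * Real.log x := by
      rw [← Real.log_pow, ← Real.log_mul hM0.ne' (by positivity)]
      exact Real.log_le_log hNpos hNM
    have h2 : (2 * N : ℝ) ^ c ≤ (2 * M) ^ c * (x : ℝ) ^ (r * c) := by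
      rw [Real.rpow_natCast_mul hxpos.le, ← Real.mul_rpow (by positivity) (by positivity)]
      refine Real.rpow_le_rpow (by positivity) ?_ hc
      linarith
    linarith
  have hlt := hx₀ x (by omega)
  have hth := Chebyshev.theta_nonneg x
  have h3 : (N : ℝ) / 2 * Chebyshev.theta x ≤ N * Real.log (N * B) :=
    (mul_le_mul_of_nonneg_right hhalf hth).trans hlogs
  have h4 : Chebyshev.theta x ≤ 2 * Real.log (N * B) := by
    have : (N : ℝ) * Chebyshev.theta x ≤ N * (2 * Real.log (N * B)) := by linarith
    exact le_of_mul_le_mul_left this hNpos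
  linarith

section LinearRecurrence

open Polynomial

/-- The shift `a ↦ (a (n + 1))ₙ` on sequences. -/
def seqShift (R : Type*) [CommRing R] : Module.End R (ℕ → R) := LinearMap.funLeft R R Nat.succ

section CommRing

variable {R : Type*} [CommRing R]

theorem seqShift_pow_apply (k : ℕ) (a : ℕ → R) (n : ℕ) : (seqShift R ^ k) a n = a (n + k) := by
  induction k generalizing a with
  | zero => simp
  | succ k ih =>
    rw [pow_succ, Module.End.mul_apply, ih]
    simp [seqShift, LinearMap.funLeft_apply, add_assoc]

theorem aeval_seqShift_apply {f : R[X]} {N : ℕ} (hf : f.natDegree < N) (a : ℕ → R) (n : ℕ) :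
    aeval (seqShift R) f a n = ∑ i ∈ Finset.range N, f.coeff i * a (n + i) := by
  rw [aeval_eq_sum_range' hf, LinearMap.sum_apply, Finset.sum_apply]
  simp [seqShift_pow_apply]

theorem aeval_seqShift_mul (f g : R[X]) (a : ℕ → R) :
    aeval (seqShift R) (f * g) a = aeval (seqShift R) f (aeval (seqShift R) g a) := by
  rw [map_mul, Module.End.mul_apply]

theorem aeval_seqShift_eq_zero_of_dvd {f g : R[X]} (h : f ∣ g) {a : ℕ → R}
    (hf : aeval (seqShift R) f a = 0) : aeval (seqShift R) g a = 0 := by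
  obtain ⟨k, rfl⟩ := h
  rw [mul_comm, aeval_seqShift_mul, hf, map_zero]

theorem aeval_seqShift_map {K : Type*} [CommRing K] (φ : R →+* K) (f : R[X]) (a : ℕ → R) (n : ℕ) :
    aeval (seqShift K) (f.map φ) (fun i => φ (a i)) n = φ (aeval (seqShift R) f a n) := by
  rw [aeval_seqShift_apply (Nat.lt_succ_of_le natDegree_map_le),
    aeval_seqShift_apply (Nat.lt_succ_self _), map_sum]
  simp

theorem det_hankelMatrix_map {K : Type*} [CommRing K] (φ : R →+* K) (a : ℕ → R) (N : ℕ) :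
    (hankelMatrix (fun i => φ (a i)) N).det = φ (hankelMatrix a N).det := by
  rw [RingHom.map_det]
  rfl

/-- A sequence killed by a monic polynomial in the shift vanishes if its first terms do. -/
theorem eq_zero_of_aeval_seqShift_eq_zero {Q : R[X]} (hQ : Q.Monic) {a : ℕ → R}
    (ha : aeval (seqShift R) Q a = 0) (h0 : ∀ i < Q.natDegree, a i = 0) : a = 0 := by
  funext k
  induction k using Nat.strong_induction_on with
  | _ k ih =>
    rcases lt_or_ge k Q.natDegree with hk | hk
    · exact h0 k hk
    · have h := congrFun ha (k - Q.natDegree)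
      rw [aeval_seqShift_apply (Nat.lt_succ_self _), Finset.sum_range_succ,
        Finset.sum_eq_zero, zero_add, hQ.coeff_natDegree, one_mul, Nat.sub_add_cancel hk] at h
      · exact h
      · intro i hi
        rw [Finset.mem_range] at hi
        rw [ih _ (by omega), Pi.zero_apply, mul_zero]

end CommRing

section Field

variable {K : Type*} [Field K]

theorem det_hankelMatrix_eq_zero_iff {a : ℕ → K} {N : ℕ} :
    (hankelMatrix a N).det = 0 ↔
      ∃ f : K[X], f ≠ 0 ∧ f.degree < N ∧ ∀ j < N, aeval (seqShift K) f a j = 0 := by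
  have key (f : K[X]) (hf : f.degree < N) (hN : N ≠ 0) (j : Fin N) :
      aeval (seqShift K) f a j =
        (hankelMatrix a N).mulVec (degreeLTEquiv K N ⟨f, mem_degreeLT.mpr hf⟩) j := by
    have hf' : f.natDegree < N := by
      rcases eq_or_ne f 0 with rfl | hf0
      · simpa using hN.bot_lt
      · exact (natDegree_lt_iff_degree_lt hf0).mpr hf
    rw [aeval_seqShift_apply hf',
      ← Fin.sum_univ_eq_sum_range (fun i => f.coeff i * a (j + i))]
    simp [Matrix.mulVec, dotProduct, hankelMatrix, degreeLTEquiv, mul_comm]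
  rw [← Matrix.exists_mulVec_eq_zero_iff]
  rcases eq_or_ne N 0 with rfl | hN
  · constructor
    · rintro ⟨v, hv, -⟩
      exact absurd (Subsingleton.elim v 0) hv
    · rintro ⟨f, hf, hdeg, -⟩
      simp [hf] at hdeg
  constructor
  · rintro ⟨v, hv, hHv⟩
    have hmem := mem_degreeLT.mp ((degreeLTEquiv K N).symm v).2
    refine ⟨(degreeLTEquiv K N).symm v, ?_, hmem, fun j hj => ?_⟩
    · simpa using hv
    · rw [show j = ((⟨j, hj⟩ : Fin N) : ℕ) from rfl, key _ hmem hN]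
      simp [hHv]
  · rintro ⟨f, hf, hdeg, hfa⟩
    refine ⟨degreeLTEquiv K N ⟨f, mem_degreeLT.mpr hdeg⟩, ?_, ?_⟩
    · simpa using hf
    · funext j
      rw [← key f hdeg hN]
      exact hfa j j.2

theorem eq_zero_of_det_hankelMatrix_ne_zero {a : ℕ → K} {N : ℕ}
    (h : (hankelMatrix a N).det ≠ 0) {f : K[X]} (hf : f.degree < N)
    (hfa : ∀ j < N, aeval (seqShift K) f a j = 0) : f = 0 := by
  by_contra hf0
  exact h (det_hankelMatrix_eq_zero_iff.mpr ⟨f, hf0, hf, hfa⟩)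

/-- **Kronecker's rationality criterion**: if the Hankel determinants vanish from some size on,
then the sequence is linearly recurrent. -/
theorem exists_monic_aeval_seqShift_eq_zero {a : ℕ → K} {n : ℕ}
    (hn : (hankelMatrix a n).det ≠ 0) (hzero : ∀ m, n < m → (hankelMatrix a m).det = 0) :
    ∃ Q : K[X], Q.Monic ∧ Q.natDegree = n ∧ aeval (seqShift K) Q a = 0 := by
  have hker (m : ℕ) (hm : n ≤ m) : ∃ f : K[X], f ≠ 0 ∧ n ≤ f.natDegree ∧ f.natDegree ≤ m ∧
      ∀ j ≤ m, aeval (seqShift K) f a j = 0 := by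
    obtain ⟨f, hf, hdeg, hfa⟩ := det_hankelMatrix_eq_zero_iff.mp (hzero (m + 1) (by omega))
    refine ⟨f, hf, ?_, ?_, fun j hj => hfa j (by omega)⟩
    · by_contra! hlt
      exact hf (eq_zero_of_det_hankelMatrix_ne_zero hn ((natDegree_lt_iff_degree_lt hf).mp hlt)
        fun j hj => hfa j (by omega))
    · exact Nat.lt_succ_iff.mp ((natDegree_lt_iff_degree_lt hf).mpr hdeg)
  obtain ⟨f₀, hf₀, hge, hle, hf₀a⟩ := hker n le_rfl
  have hQ : (C f₀.leadingCoeff⁻¹ * f₀).Monic := by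
    rw [mul_comm]
    exact monic_mul_leadingCoeff_inv hf₀
  have hQdeg : (C f₀.leadingCoeff⁻¹ * f₀).natDegree = n := by
    rw [natDegree_C_mul (inv_ne_zero (leadingCoeff_ne_zero.mpr hf₀))]
    omega
  refine ⟨_, hQ, hQdeg, ?_⟩
  set Q := C f₀.leadingCoeff⁻¹ * f₀ with hQdef
  funext m
  induction m using Nat.strong_induction_on with
  | _ m ih =>
    rcases le_or_gt m n with hm | hm
    · rw [hQdef, aeval_seqShift_mul, aeval_C, Module.algebraMap_end_apply, Pi.smul_apply,
        hf₀a m hm, smul_zero, Pi.zero_apply]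
    · obtain ⟨f, hf, hfge, hfle, hfa⟩ := hker m hm.le
      have h1 : aeval (seqShift K) (f * Q) a (m - f.natDegree) = 0 := by
        rw [mul_comm, aeval_seqShift_mul, aeval_seqShift_apply (Nat.lt_succ_self _)]
        refine Finset.sum_eq_zero fun i hi => ?_
        rw [Finset.mem_range] at hi
        rw [hfa _ (by omega), mul_zero]
      rw [aeval_seqShift_mul, aeval_seqShift_apply (Nat.lt_succ_self _), Finset.sum_range_succ,
        Finset.sum_eq_zero, zero_add, Nat.sub_add_cancel hfle] at h1
      · simpa [hf] using h1
      · intro i hi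
        rw [Finset.mem_range] at hi
        rw [ih _ (by omega), Pi.zero_apply, mul_zero]

end Field

/-- An integer sequence that is linearly recurrent over `ℚ` satisfies a monic integral linear
recurrence. -/
theorem exists_monic_int_aeval_seqShift_eq_zero {A : ℕ → ℤ} {Q : ℚ[X]} (hQ : Q.Monic)
    (hQA : aeval (seqShift ℚ) Q (fun i => (A i : ℚ)) = 0) :
    ∃ P : ℤ[X], P.Monic ∧ aeval (seqShift ℤ) P A = 0 := by
  let T : ℤ[X] →ₗ[ℤ] (Fin Q.natDegree → ℤ) :=
    { toFun := fun f i => aeval (seqShift ℤ) f A i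
      map_add' := fun f g => by funext i; simp
      map_smul' := fun c f => by funext i; simp }
  let M : ℕ →o Submodule ℤ (Fin Q.natDegree → ℤ) :=
    ⟨fun k => (degreeLT ℤ k).map T, fun k l hkl => Submodule.map_mono (degreeLT_mono hkl)⟩
  obtain ⟨k, hk⟩ := monotone_stabilizes_iff_noetherian.mpr
    (inferInstance : IsNoetherian ℤ (Fin Q.natDegree → ℤ)) M
  have hX : T (X ^ k) ∈ M k := by
    rw [hk (k + 1) k.le_succ]
    refine Submodule.mem_map_of_mem (mem_degreeLT.mpr ?_)
    rw [degree_X_pow]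
    exact_mod_cast k.lt_succ_self
  obtain ⟨g, hg, hgX⟩ := Submodule.mem_map.mp hX
  refine ⟨X ^ k - g, monic_X_pow_sub (by simpa [mem_degreeLT] using hg), ?_⟩
  have hT : T (X ^ k - g) = 0 := by rw [map_sub, hgX, sub_self]
  have hz : aeval (seqShift ℚ) ((X ^ k - g).map (Int.castRingHom ℚ)) (fun i => (A i : ℚ)) = 0 := by
    refine eq_zero_of_aeval_seqShift_eq_zero hQ ?_ fun i hi => ?_
    · rw [← aeval_seqShift_mul, mul_comm, aeval_seqShift_mul, hQA, map_zero]
    · have h1 : aeval (seqShift ℤ) (X ^ k - g) A i = 0 := congrFun hT ⟨i, hi⟩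
      have h2 := aeval_seqShift_map (Int.castRingHom ℚ) (X ^ k - g) A i
      rw [h1, map_zero] at h2
      exact h2
  funext i
  have h3 := aeval_seqShift_map (Int.castRingHom ℚ) (X ^ k - g) A i
  have h4 := h3.symm.trans (congrFun hz i)
  exact (Int.castRingHom ℚ).injective_int (h4.trans (map_zero _).symm)

theorem exists_minimal_int_aeval_seqShift_eq_zero {A : ℕ → ℤ}
    (hA : ∀ᶠ N : ℕ in atTop, (hankelMatrix A N).det = 0) :
    ∃ Q : ℤ[X], Q.Monic ∧ aeval (seqShift ℤ) Q A = 0 ∧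
      (hankelMatrix A Q.natDegree).det ≠ 0 := by
  obtain ⟨N₀, hN₀⟩ := eventually_atTop.mp hA
  set n := Nat.findGreatest (fun m => (hankelMatrix A m).det ≠ 0) N₀ with hndef
  have hn : (hankelMatrix A n).det ≠ 0 :=
    Nat.findGreatest_spec (P := fun m => (hankelMatrix A m).det ≠ 0) (Nat.zero_le _) (by simp)
  have hgt (m : ℕ) (hm : n < m) : (hankelMatrix A m).det = 0 := by
    by_contra h
    rcases le_or_gt m N₀ with hmN | hmN
    · exact absurd (Nat.le_findGreatest hmN h) hm.not_ge
    · exact h (hN₀ m hmN.le)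
  have hdet (m : ℕ) : (hankelMatrix (fun i => (A i : ℚ)) m).det = (hankelMatrix A m).det :=
    det_hankelMatrix_map (Int.castRingHom ℚ) A m
  have hnQ : (hankelMatrix (fun i => (A i : ℚ)) n).det ≠ 0 := by
    rw [hdet]
    exact_mod_cast hn
  obtain ⟨Q, hQ, hQn, hQA⟩ := exists_monic_aeval_seqShift_eq_zero hnQ fun m hm => by
    rw [hdet, hgt m hm, Int.cast_zero]
  obtain ⟨P, hP, hPA⟩ := exists_monic_int_aeval_seqShift_eq_zero hQ hQA
  have hPA' : aeval (seqShift ℚ) (P.map (Int.castRingHom ℚ)) (fun i => (A i : ℚ)) = 0 := by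
    funext i
    have h := aeval_seqShift_map (Int.castRingHom ℚ) P A i
    rwa [hPA, Pi.zero_apply, map_zero] at h
  have hdvd : Q ∣ P.map (algebraMap ℤ ℚ) := by
    rw [← modByMonic_eq_zero_iff_dvd hQ]
    refine eq_zero_of_det_hankelMatrix_ne_zero hnQ ?_ fun j _ => ?_
    · rw [← hQn, ← degree_eq_natDegree hQ.ne_zero]
      exact degree_modByMonic_lt _ hQ
    · have h := congrArg (fun f => aeval (seqShift ℚ) f (fun i => (A i : ℚ)) j)
        (modByMonic_add_div (P.map (algebraMap ℤ ℚ)) Q)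
      simp only [map_add, LinearMap.add_apply, Pi.add_apply] at h
      rw [mul_comm, aeval_seqShift_mul, hQA, map_zero, Pi.zero_apply, add_zero] at h
      exact h.trans (congrFun hPA' j)
  obtain ⟨Q', hQ'⟩ := IsIntegrallyClosed.eq_map_mul_C_of_dvd ℚ hP hdvd
  rw [hQ.leadingCoeff, C_1, mul_one] at hQ'
  have hdeg : Q'.natDegree = n := by
    rw [← hQn, ← hQ', natDegree_map_eq_of_injective (algebraMap ℤ ℚ).injective_int]
  refine ⟨Q', ?_, ?_, hdeg ▸ hn⟩
  · exact monic_of_injective (algebraMap ℤ ℚ).injective_int (hQ' ▸ hQ)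
  · funext i
    have h := aeval_seqShift_map (algebraMap ℤ ℚ) Q' A i
    rw [hQ'] at h
    have h' := h.symm.trans (congrFun hQA i)
    exact (algebraMap ℤ ℚ).injective_int (h'.trans (map_zero _).symm)

theorem exists_dvd_pow_of_roots_of_unity (s : Multiset ℂ)
    (hs : ∀ α ∈ s, α = 0 ∨ ∃ k, 0 < k ∧ α ^ k = 1) :
    ∃ d m : ℕ, 0 < d ∧ (s.map fun α => X - C α).prod ∣ (X * (X ^ d - 1) : ℂ[X]) ^ m := by
  induction s using Multiset.induction_on with
  | empty => exact ⟨1, 0, one_pos, by simp⟩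
  | cons α s ih =>
    obtain ⟨d, m, hd, hdvd⟩ := ih fun β hβ => hs β (Multiset.mem_cons_of_mem hβ)
    obtain ⟨k, hk, hα⟩ : ∃ k, 0 < k ∧ X - C α ∣ (X * (X ^ k - 1) : ℂ[X]) := by
      rcases hs α (Multiset.mem_cons_self α s) with rfl | ⟨k, hk, hα⟩
      · exact ⟨1, one_pos, by simp⟩
      · exact ⟨k, hk, dvd_mul_of_dvd_right (dvd_iff_isRoot.mpr (by simp [hα])) _⟩
    refine ⟨d * k, m + 1, Nat.mul_pos hd hk, ?_⟩
    have hpow (u v : ℕ) : (X * (X ^ u - 1) : ℂ[X]) ∣ X * (X ^ (u * v) - 1) :=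
      mul_dvd_mul_left _ (pow_one_sub_dvd_pow_mul_sub_one _ _ _)
    rw [Multiset.map_cons, Multiset.prod_cons, pow_succ']
    refine mul_dvd_mul (hα.trans ?_) (hdvd.trans (pow_dvd_pow_of_dvd (hpow d k) m))
    rw [mul_comm d k]
    exact hpow k d

/-- The characteristic roots of a minimal linear recurrence of a subexponential sequence lie in
the closed unit disc. -/
theorem norm_root_le_one {a : ℕ → ℂ}
    (ha : ∀ ρ : ℝ, 1 < ρ → Tendsto (fun n => ‖a n‖ / ρ ^ n) atTop (nhds 0))
    {Q : ℂ[X]} (hQ : Q ≠ 0) (hQa : aeval (seqShift ℂ) Q a = 0)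
    (hdet : (hankelMatrix a Q.natDegree).det ≠ 0) {α : ℂ} (hα : Q.IsRoot α) : ‖α‖ ≤ 1 := by
  by_contra! hα1
  have hα0 : α ≠ 0 := by
    rintro rfl
    simp at hα1
    linarith
  obtain ⟨g, rfl⟩ := dvd_iff_isRoot.mpr hα
  have hg0 : g ≠ 0 := right_ne_zero_of_mul hQ
  have hdeg : g.natDegree < ((X - C α) * g).natDegree := by
    rw [natDegree_mul (X_sub_C_ne_zero α) hg0, natDegree_X_sub_C]
    omega
  set b := aeval (seqShift ℂ) g a with hb
  have hgeom (n : ℕ) : b n = α ^ n * b 0 := by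
    induction n with
    | zero => simp
    | succ n ih =>
      have h := congrFun hQa n
      rw [aeval_seqShift_mul, ← hb, map_sub, aeval_X, aeval_C, LinearMap.sub_apply] at h
      have h' : b (n + 1) - α * b n = 0 := h
      rw [sub_eq_zero.mp h', ih]
      ring
  have hlim : Tendsto (fun n => b n / α ^ n) atTop (nhds 0) := by
    have h1 : Tendsto (fun n => a n / α ^ n) atTop (nhds 0) := by
      rw [tendsto_zero_iff_norm_tendsto_zero]
      simpa using ha ‖α‖ hα1
    have h2 : Tendsto (fun n => ∑ i ∈ Finset.range (g.natDegree + 1),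
        g.coeff i * α ^ i * (a (n + i) / α ^ (n + i))) atTop (nhds 0) := by
      rw [← Finset.sum_const_zero (s := Finset.range (g.natDegree + 1))]
      refine tendsto_finsetSum _ fun i _ => ?_
      simpa using (h1.comp (tendsto_add_atTop_nat i)).const_mul (g.coeff i * α ^ i)
    refine h2.congr fun n => ?_
    rw [hb, aeval_seqShift_apply (Nat.lt_succ_self _), Finset.sum_div]
    refine Finset.sum_congr rfl fun i _ => ?_
    rw [pow_add]
    field_simp
  have hb0 : b 0 = 0 := by
    refine tendsto_nhds_unique (tendsto_const_nhds.congr fun n => ?_) hlim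
    rw [hgeom n]
    field_simp
  refine hg0 (eq_zero_of_det_hankelMatrix_ne_zero hdet ?_ fun j _ => ?_)
  · exact (natDegree_lt_iff_degree_lt hg0).mp hdeg
  · rw [← hb, hgeom, hb0, mul_zero]

theorem root_eq_zero_or_pow_eq_one {Q : ℤ[X]} (hQ : Q.Monic)
    (hroots : ∀ α ∈ Q.aroots ℂ, ‖α‖ ≤ 1) {α : ℂ} (hα : α ∈ Q.aroots ℂ) :
    α = 0 ∨ ∃ k, 0 < k ∧ α ^ k = 1 := by
  refine or_iff_not_imp_left.mpr fun hα0 => ?_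
  refine pow_eq_one_of_mahlerMeasure_eq_one (p := Q) ?_ hα0 hα
  rw [mahlerMeasure_eq_leadingCoeff_mul_prod_roots, (hQ.map (Int.castRingHom ℂ)).leadingCoeff,
    norm_one, one_mul]
  refine Multiset.prod_eq_one fun y hy => ?_
  obtain ⟨β, hβ, rfl⟩ := Multiset.mem_map.mp hy
  exact max_eq_left (hroots β hβ)

theorem exists_aeval_seqShift_pow_eq_zero {A : ℕ → ℤ}
    (hA : ∀ᶠ N : ℕ in atTop, (hankelMatrix A N).det = 0)
    (hgrowth : ∀ ρ : ℝ, 1 < ρ → Tendsto (fun n => |(A n : ℝ)| / ρ ^ n) atTop (nhds 0)) :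
    ∃ d m : ℕ, 0 < d ∧ aeval (seqShift ℤ) ((X * (X ^ d - 1) : ℤ[X]) ^ m) A = 0 := by
  obtain ⟨Q, hQ, hQA, hdet⟩ := exists_minimal_int_aeval_seqShift_eq_zero hA
  let φ := algebraMap ℤ ℂ
  have hQ' : (Q.map φ).Monic := hQ.map φ
  have hQA' : aeval (seqShift ℂ) (Q.map φ) (fun i => φ (A i)) = 0 := by
    funext i
    rw [aeval_seqShift_map, hQA, Pi.zero_apply, map_zero, Pi.zero_apply]
  have hdet' : (hankelMatrix (fun i => φ (A i)) (Q.map φ).natDegree).det ≠ 0 := by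
    rw [natDegree_map_eq_of_injective φ.injective_int, det_hankelMatrix_map]
    exact (map_ne_zero_iff φ φ.injective_int).mpr hdet
  have hnorm (α : ℂ) (hα : α ∈ Q.aroots ℂ) : ‖α‖ ≤ 1 := by
    refine norm_root_le_one (fun ρ hρ => ?_) hQ'.ne_zero hQA' hdet' (isRoot_of_mem_roots hα)
    simpa [φ] using hgrowth ρ hρ
  obtain ⟨d, m, hd, hdvd⟩ := exists_dvd_pow_of_roots_of_unity (Q.aroots ℂ)
    fun α hα => root_eq_zero_or_pow_eq_one hQ hnorm hα
  refine ⟨d, m, hd, ?_⟩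
  have hprod : ((Q.aroots ℂ).map fun α => X - C α).prod = Q.map φ :=
    ((IsAlgClosed.splits (Q.map φ)).eq_prod_roots_of_monic hQ').symm
  rw [hprod] at hdvd
  have hz := aeval_seqShift_eq_zero_of_dvd hdvd hQA'
  have hmap : (X * (X ^ d - 1) : ℂ[X]) ^ m = ((X * (X ^ d - 1) : ℤ[X]) ^ m).map φ := by simp
  funext i
  have h := aeval_seqShift_map φ ((X * (X ^ d - 1) : ℤ[X]) ^ m) A i
  rw [← hmap, hz, Pi.zero_apply] at h
  exact φ.injective_int (h.symm.trans (map_zero _).symm)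

theorem exists_polynomial_eval_eq_choose (k : ℕ) :
    ∃ q : ℚ[X], ∀ t : ℕ, q.eval (t : ℚ) = t.choose k := by
  refine ⟨C (k.factorial : ℚ)⁻¹ * descPochhammer ℚ k, fun t => ?_⟩
  have : (k.factorial : ℚ) ≠ 0 := by exact_mod_cast k.factorial_ne_zero
  rw [eval_mul, eval_C, descPochhammer_eval_eq_descFactorial,
    Nat.descFactorial_eq_factorial_mul_choose, Nat.cast_mul, inv_mul_cancel_left₀ this]

theorem eventually_eq_polynomial_of_aeval_seqShift {A : ℕ → ℤ} {d m : ℕ} (hd : 0 < d)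
    (hA : aeval (seqShift ℤ) ((X * (X ^ d - 1) : ℤ[X]) ^ m) A = 0) (i : ℕ) :
    ∃ q : ℚ[X], ∀ᶠ n : ℕ in atTop, (A (n * d + i) : ℚ) = q.eval (n : ℚ) := by
  set A' : ℕ → ℤ := aeval (seqShift ℤ) (X ^ m : ℤ[X]) A with hA'def
  have hA' (n : ℕ) : A' n = A (n + m) := by
    rw [hA'def, map_pow, aeval_X, seqShift_pow_apply]
  have hdiff (k : ℕ) (f : ℕ → ℤ) :
      aeval (seqShift ℤ) ((X ^ d - 1) ^ k : ℤ[X]) f = (fwdDiff d)^[k] f := by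
    induction k generalizing f with
    | zero => simp
    | succ k ih =>
      rw [pow_succ, aeval_seqShift_mul, ih, Function.iterate_succ_apply]
      congr 1
      funext n
      simp [fwdDiff, seqShift_pow_apply]
  have hzero (k : ℕ) (hk : m ≤ k) : (fwdDiff d)^[k] A' = 0 := by
    rw [← hdiff, hA'def, ← aeval_seqShift_mul]
    refine aeval_seqShift_eq_zero_of_dvd ?_ hA
    rw [mul_pow, mul_comm]
    exact mul_dvd_mul_right (pow_dvd_pow _ hk) _
  choose q hq using exists_polynomial_eval_eq_choose
  have hmd : m ≤ m * d := Nat.le_mul_of_pos_right m hd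
  set y := m * d - m + i with hy
  refine ⟨∑ k ∈ Finset.range m, (((fwdDiff d)^[k] A' y : ℤ) : ℚ[X]) * (q k).comp (X - C (m : ℚ)), ?_⟩
  filter_upwards [eventually_ge_atTop m] with n hn
  obtain ⟨t, rfl⟩ := Nat.exists_eq_add_of_le hn
  have h1 : A ((m + t) * d + i) = A' (y + t • d) := by
    rw [hA', smul_eq_mul, add_mul]
    congr 1
    omega
  have h2 : A' (y + t • d) = ∑ k ∈ Finset.range m, (t.choose k : ℤ) * (fwdDiff d)^[k] A' y := by
    rw [shift_eq_sum_fwdDiff_iter d A' t y]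
    simp_rw [nsmul_eq_mul]
    trans ∑ k ∈ Finset.range (t + 1 + m), (t.choose k : ℤ) * (fwdDiff d)^[k] A' y
    · refine Finset.sum_subset (Finset.range_mono (by omega)) fun k _ hk => ?_
      rw [Nat.choose_eq_zero_of_lt (by simpa using hk), Nat.cast_zero, zero_mul]
    · refine (Finset.sum_subset (Finset.range_mono (by omega)) fun k _ hk => ?_).symm
      rw [hzero k (by simpa using hk), Pi.zero_apply, mul_zero]
  rw [h1, h2, eval_finsetSum, Int.cast_sum]
  refine Finset.sum_congr rfl fun k _ => ?_
  rw [eval_mul, eval_comp, eval_sub, eval_X, eval_C, Nat.cast_add, add_sub_cancel_left, hq,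
    eval_intCast]
  push_cast
  ring

end LinearRecurrence

theorem exists_abs_le_mul_exp_rpow {A : ℕ → ℤ} {c : ℝ}
    (hA : ∀ᶠ n : ℕ in atTop,
      2 ≤ |A n| → Real.log (Real.log (|A n| : ℝ)) ≤ c * Real.log (n : ℝ)) :
    ∃ C : ℝ, 0 < C ∧ ∀ n : ℕ, |(A n : ℝ)| ≤ C * Real.exp ((n : ℝ) ^ c) := by
  obtain ⟨n₀, hn₀⟩ := eventually_atTop.mp hA
  have hsum : 0 ≤ ∑ m ∈ Finset.range (n₀ + 1), |(A m : ℝ)| :=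
    Finset.sum_nonneg fun _ _ => abs_nonneg _
  refine ⟨1 + ∑ m ∈ Finset.range (n₀ + 1), |(A m : ℝ)|, by linarith, fun n => ?_⟩
  have hexp : 1 ≤ Real.exp ((n : ℝ) ^ c) := Real.one_le_exp (Real.rpow_nonneg n.cast_nonneg c)
  rcases le_or_gt n n₀ with hn | hn
  · have h1 : |(A n : ℝ)| ≤ ∑ m ∈ Finset.range (n₀ + 1), |(A m : ℝ)| :=
      Finset.single_le_sum (f := fun m => |(A m : ℝ)|) (fun _ _ => abs_nonneg _)
        (Finset.mem_range.mpr (by omega))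
    nlinarith
  · suffices h : |(A n : ℝ)| ≤ Real.exp ((n : ℝ) ^ c) by nlinarith
    rcases lt_or_ge |A n| 2 with hlt | hge
    · have : |A n| ≤ 1 := by omega
      have : |(A n : ℝ)| ≤ 1 := by exact_mod_cast this
      linarith
    · have hge' : (2 : ℝ) ≤ |(A n : ℝ)| := by exact_mod_cast hge
      have hn0 : (0 : ℝ) < n := by exact_mod_cast (by omega : 0 < n)
      rw [← Real.log_le_iff_le_exp (by linarith),
        ← Real.log_le_log_iff (Real.log_pos (by linarith)) (Real.rpow_pos_of_pos hn0 c),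
        Real.log_rpow hn0]
      exact hn₀ n hn.le hge

theorem tendsto_abs_div_pow_of_le_exp_rpow {A : ℕ → ℤ} {c C : ℝ} (hc : c < 1)
    (hA : ∀ n : ℕ, |(A n : ℝ)| ≤ C * Real.exp ((n : ℝ) ^ c)) {ρ : ℝ} (hρ : 1 < ρ) :
    Tendsto (fun n => |(A n : ℝ)| / ρ ^ n) atTop (nhds 0) := by
  have hlog := Real.log_pos hρ
  have hlim : Tendsto (fun n : ℕ => C * Real.exp (-(Real.log ρ / 2 * n))) atTop (nhds 0) := by
    rw [← mul_zero C]
    refine (Real.tendsto_exp_neg_atTop_nhds_zero.comp ?_).const_mul C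
    exact tendsto_natCast_atTop_atTop.const_mul_atTop (by positivity)
  have hC : 0 ≤ C := by
    have h := (abs_nonneg _).trans (hA 0)
    exact nonneg_of_mul_nonneg_left h (Real.exp_pos _)
  have hsmall := tendsto_natCast_atTop_atTop.eventually
    ((isLittleO_rpow_id_atTop hc).def (half_pos hlog))
  refine squeeze_zero' (Eventually.of_forall fun n => by positivity) ?_ hlim
  filter_upwards [hsmall] with n hn
  rw [Real.norm_of_nonneg (by positivity), Real.norm_of_nonneg (by positivity)] at hn
  rw [div_le_iff₀ (by positivity), mul_assoc]
  refine (hA n).trans (mul_le_mul_of_nonneg_left ?_ hC)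
  rw [← Real.exp_log (by linarith : 0 < ρ), ← Real.exp_nat_mul, ← Real.exp_add, Real.log_exp]
  exact Real.exp_le_exp.mpr (by linarith)

/-- **Corollary 1.6.** If an integer sequence `A` satisfies a polynomial recurrence
`A(n+r) = p(A(n+r−1), …, A(n))`, then either `limsup_n log log |A(n)| / log n ≥ 1/r`
(the limsup taken over the `n` with `|A(n)| ≥ 2`), or else there is a `d ≥ 1` such that each
subsequence `(A(nd+i))ₙ`, `0 ≤ i < d`, is eventually given by a polynomial with rational
coefficients. -/
theorem polynomial_recurrence_growth_dichotomy
    (r : ℕ) (hr : 0 < r) (A : ℕ → ℤ) (p : MvPolynomial (Fin r) ℤ)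
    (hrec : ∀ n : ℕ, A (n + r) =
      MvPolynomial.eval (fun i : Fin r => A (n + r - 1 - (i : ℕ))) p) :
    (∀ c : ℝ, c < 1 / (r : ℝ) → ∃ᶠ n : ℕ in atTop,
      2 ≤ |A n| ∧ c * Real.log (n : ℝ) < Real.log (Real.log (|A n| : ℝ))) ∨
    (∃ d : ℕ, 0 < d ∧ ∀ i : ℕ, i < d → ∃ q : Polynomial ℚ,
      ∀ᶠ n : ℕ in atTop, (A (n * d + i) : ℚ) = q.eval (n : ℚ)) := by
  rw [or_iff_not_imp_left]
  intro h
  push Not at h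
  obtain ⟨c, hc, hA⟩ := h
  have hr' : (1 : ℝ) ≤ r := by exact_mod_cast hr
  have hcr : max c 0 < 1 / (r : ℝ) := max_lt hc (by positivity)
  obtain ⟨C, hC, hbound⟩ := exists_abs_le_mul_exp_rpow (A := A) (c := max c 0) <| by
    filter_upwards [hA] with n hn h2
    refine (hn h2).trans ?_
    exact mul_le_mul_of_nonneg_right (le_max_left c 0) (Real.log_natCast_nonneg n)
  obtain ⟨d, m, hd, hdm⟩ := exists_aeval_seqShift_pow_eq_zero
    (eventually_det_hankelMatrix_eq_zero hr hrec (le_max_right c 0) hcr hC hbound)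
    fun ρ hρ => tendsto_abs_div_pow_of_le_exp_rpow
      (hcr.trans_le (div_le_one_of_le₀ hr' (by positivity))) hbound hρ
  exact ⟨d, hd, fun i _ => eventually_eq_polynomial_of_aeval_seqShift hd hdm i⟩
end

section
/- Let f : ℤ^r → ℤ^r be any set-theoretic map and P ∈ ℤ^r a point whose forward orbit (f^n P)_{n ∈ ℕ} is infinite. Then limsup_{n→∞} h_aff(f^n P) / log n ≥ 1/r. -/
/-- The affine logarithmic Weil height of an integer point of `𝔸^r`:
`h_aff(x) = log max(1, |x_1|, …, |x_r|)`. -/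
noncomputable def intAffHeight {r : ℕ} (x : Fin r → ℤ) : ℝ :=
  Real.log (max 1 (⨆ j, |(x j : ℝ)|))

/-- The iterates of a point with infinite forward orbit are pairwise distinct. -/
theorem injective_iterate_of_infinite_range {α : Type*} (f : α → α) (x : α)
    (hinf : (Set.range fun n => f^[n] x).Infinite) :
    Function.Injective fun n => f^[n] x := by
  refine Function.Injective.of_lt_imp_ne fun m n hmn heq => hinf ?_
  refine ((Set.finite_Iio n).image fun k => f^[k] x).subset ?_
  rintro _ ⟨k, rfl⟩
  induction k using Nat.strong_induction_on with
  | _ k ih =>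
    by_cases hk : k < n
    · exact ⟨k, hk, rfl⟩
    · have h : f^[k] x = f^[k - n + m] x := by
        have hk' : k = k - n + n := by omega
        conv_lhs => rw [hk']
        rw [Function.iterate_add_apply, Function.iterate_add_apply]
        exact congrArg _ heq.symm
      have := ih (k - n + m) (by omega)
      simpa only [h] using this

theorem abs_le_exp_intAffHeight {r : ℕ} (x : Fin r → ℤ) (j : Fin r) :
    |(x j : ℝ)| ≤ Real.exp (intAffHeight x) := by
  rw [intAffHeight, Real.exp_log (lt_max_of_lt_left one_pos)]
  exact (le_ciSup (f := fun j => |(x j : ℝ)|) (Set.finite_range _).bddAbove j).trans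
    (le_max_right _ _)

/-- A finite set of integer points whose coordinates are bounded by `B ≥ 1` has at most
`(3B)^r` elements. -/
theorem card_le_of_abs_le {r : ℕ} (s : Finset (Fin r → ℤ)) (B : ℝ) (hB : 1 ≤ B)
    (hs : ∀ x ∈ s, ∀ j, |(x j : ℝ)| ≤ B) : (s.card : ℝ) ≤ (3 * B) ^ r := by
  have hsub : s ⊆ Fintype.piFinset fun _ => Finset.Icc (-⌊B⌋) ⌊B⌋ := by
    intro x hx
    refine Fintype.mem_piFinset.2 fun j => Finset.mem_Icc.2 (abs_le.1 (Int.le_floor.2 ?_))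
    exact_mod_cast hs x hx j
  have hfloor : 0 ≤ ⌊B⌋ := Int.floor_nonneg.2 (by linarith)
  have hcard : (((Finset.Icc (-⌊B⌋) ⌊B⌋).card : ℕ) : ℝ) ≤ 3 * B := by
    have h : (((Finset.Icc (-⌊B⌋) ⌊B⌋).card : ℕ) : ℤ) = ⌊B⌋ + 1 + ⌊B⌋ := by
      rw [Int.card_Icc, Int.toNat_of_nonneg (by omega)]
      ring
    have h' : (((Finset.Icc (-⌊B⌋) ⌊B⌋).card : ℕ) : ℝ) = ⌊B⌋ + 1 + ⌊B⌋ := by exact_mod_cast h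
    rw [h']
    linarith [Int.floor_le B]
  calc (s.card : ℝ) ≤ ((Fintype.piFinset fun _ : Fin r => Finset.Icc (-⌊B⌋) ⌊B⌋).card : ℝ) := by
        exact_mod_cast Finset.card_le_card hsub
    _ = (((Finset.Icc (-⌊B⌋) ⌊B⌋).card : ℕ) : ℝ) ^ r := by
        simp only [Fintype.card_piFinset, Finset.prod_const, Finset.card_univ, Fintype.card_fin,
          Nat.cast_pow]
    _ ≤ (3 * B) ^ r := by gcongr

theorem eventually_mul_rpow_add_lt (C N d : ℝ) (hd : d < 1) :
    ∀ᶠ n : ℕ in Filter.atTop, C * (n : ℝ) ^ d + N < n := by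
  have h₁ : Filter.Tendsto (fun x : ℝ => C * x ^ (-(1 - d)) + N * x⁻¹) Filter.atTop
      (nhds (C * 0 + N * 0)) :=
    ((tendsto_rpow_neg_atTop (sub_pos.2 hd)).const_mul C).add
      (tendsto_inv_atTop_zero.const_mul N)
  have h₂ := (h₁.comp tendsto_natCast_atTop_atTop).eventually_lt_const
    (show C * 0 + N * 0 < (1 : ℝ) by norm_num)
  filter_upwards [h₂, Filter.eventually_gt_atTop 0] with n hn hpos
  have hn0 : (0 : ℝ) < n := by exact_mod_cast hpos
  have h := mul_lt_mul_of_pos_right hn hn0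
  have hpow : (n : ℝ) ^ (-(1 - d)) * n = (n : ℝ) ^ d := by
    rw [← Real.rpow_add_one hn0.ne']
    congr 1
    ring
  simp only [Function.comp_apply] at h
  rwa [add_mul, mul_assoc, hpow, mul_assoc, inv_mul_cancel₀ hn0.ne', mul_one, one_mul] at h

/-- The trivial orbit-counting bound: if `P ∈ ℤ^r` has infinite forward orbit under any
set-theoretic self-map `f` of `ℤ^r`, then `limsup_n h_aff(fⁿP) / log n ≥ 1/r`. -/
theorem trivial_orbit_growth_lower_bound
    (r : ℕ) (hr : 0 < r) (f : (Fin r → ℤ) → (Fin r → ℤ)) (P : Fin r → ℤ)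
    (hinf : (Set.range fun n => f^[n] P).Infinite) :
    ∀ c : ℝ, c < 1 / (r : ℝ) → ∃ᶠ n : ℕ in Filter.atTop,
      c * Real.log (n : ℝ) < intAffHeight (f^[n] P) := by
  intro c hc
  by_contra hfreq
  rw [Filter.not_frequently] at hfreq
  obtain ⟨N, hN⟩ := Filter.eventually_atTop.1 hfreq
  have hr' : (0 : ℝ) < r := by exact_mod_cast hr
  have hc0 : (0 : ℝ) ≤ max c 0 := le_max_right _ _
  have hd : max c 0 * r < 1 := (lt_div_iff₀ hr').1 (max_lt hc (by positivity))
  obtain ⟨M, hM, hM1⟩ := ((eventually_mul_rpow_add_lt (3 ^ r) (N + 1) (max c 0 * r) hd).and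
    (Filter.eventually_ge_atTop 1)).exists
  have hM1' : (1 : ℝ) ≤ M := by exact_mod_cast hM1
  have hcard := card_le_of_abs_le ((Finset.Ioc N M).image fun n => f^[n] P) ((M : ℝ) ^ max c 0)
    (Real.one_le_rpow hM1' hc0) (by
      intro x hx j
      obtain ⟨n, hn, rfl⟩ := Finset.mem_image.1 hx
      rw [Finset.mem_Ioc] at hn
      have hn1 : (1 : ℝ) ≤ n := by exact_mod_cast (by omega : 1 ≤ n)
      have hnM : (n : ℝ) ≤ M := by exact_mod_cast hn.2
      refine (abs_le_exp_intAffHeight _ j).trans ?_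
      rw [Real.rpow_def_of_pos (by linarith), Real.exp_le_exp]
      calc intAffHeight (f^[n] P) ≤ c * Real.log n := not_lt.1 (hN n hn.1.le)
        _ ≤ max c 0 * Real.log n :=
          mul_le_mul_of_nonneg_right (le_max_left _ _) (Real.log_nonneg hn1)
        _ ≤ max c 0 * Real.log M :=
          mul_le_mul_of_nonneg_left (Real.log_le_log (by linarith) hnM) hc0
        _ = Real.log M * max c 0 := mul_comm _ _)
  rw [Finset.card_image_of_injective _ (injective_iterate_of_infinite_range f P hinf),
    Nat.card_Ioc, mul_pow, ← Real.rpow_mul_natCast (by linarith)] at hcard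
  have hsub : (M : ℝ) ≤ ((M - N : ℕ) : ℝ) + N := by exact_mod_cast (by omega : M ≤ M - N + N)
  linarith
end
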